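/- Let t and s be KA_{x̄,1̄} terms. The following are equivalent: (1) LANG ⊨ t ≤ s; (2) for every natural number m ≤ l(t) and every valuation v over the alphabet {ℓ_0, …, ℓ_{m−1}} such that v(x) is contained in the set of (contiguous) subwords of ℓ_0 ⋯ ℓ_{m−1} for every variable x, v̂(t) ⊆ v̂(s); (3) for every set X, every natural number m ≤ l(t), every valuation v over X, and all nonempty words w_0, …, w_{m−1} ∈ X*, v̂^⟨w_0,…,w_{m−1}⟩(t) ⊆ v̂^⟨w_0,…,w_{m−1}⟩(s). -/

import Mathlib

/-- Terms of Kleene algebra with variable complements (`nvar`) and the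
complemented identity constant (`cone`), over the countably infinite
variable set `ℕ`. -/
inductive Term : Type where
  | var : ℕ → Term
  | nvar : ℕ → Term
  | zero : Term
  | one : Term
  | cone : Term
  | add : Term → Term → Term
  | comp : Term → Term → Term
  | star : Term → Term

/-- Composition (concatenation) of languages. -/
def cat {X : Type} (L M : Set (List X)) : Set (List X) :=
  {w | ∃ u ∈ L, ∃ v ∈ M, w = u ++ v}

/-- Kleene star of a language. -/
def kstar {X : Type} (L : Set (List X)) : Set (List X) :=
  {w | ∃ ws : List (List X), (∀ u ∈ ws, u ∈ L) ∧ w = ws.flatten}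

/-- The interpretation `v̂(t)` of a term under a valuation `v : V → P(X*)`. -/
def eval {X : Type} (v : ℕ → Set (List X)) : Term → Set (List X)
  | .var x => v x
  | .nvar x => (v x)ᶜ
  | .zero => ∅
  | .one => {[]}
  | .cone => ({[]} : Set (List X))ᶜ
  | .add t s => eval v t ∪ eval v s
  | .comp t s => cat (eval v t) (eval v s)
  | .star t => kstar (eval v t)

/-- The alphabet `Ṽ_{1̄} = {x, x̄ : x ∈ V} ∪ {1̄}`. -/
inductive TLetter : Type where
  | pos : ℕ → TLetter
  | neg : ℕ → TLetter
  | one : TLetter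
  deriving DecidableEq

/-- A letter of `Ṽ_{1̄}` viewed as a term. -/
def TLetter.toTerm : TLetter → Term
  | .pos x => .var x
  | .neg x => .nvar x
  | .one => .cone

/-- A word over `Ṽ_{1̄}` viewed as a term (composition of its letters,
the empty word being `1`). -/
def wordToTerm : List TLetter → Term
  | [] => .one
  | a :: w => .comp a.toTerm (wordToTerm w)

/-- The regular language `⟦t⟧_{Ṽ1̄}` of `t` read as a regular expression
over the alphabet `Ṽ_{1̄}`, where each of `x`, `x̄`, `1̄` is a single letter. -/
def syntacticLang : Term → Set (List TLetter)
  | .var x => {[.pos x]}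
  | .nvar x => {[.neg x]}
  | .zero => ∅
  | .one => {[]}
  | .cone => {[.one]}
  | .add t s => syntacticLang t ∪ syntacticLang s
  | .comp t s => cat (syntacticLang t) (syntacticLang s)
  | .star t => kstar (syntacticLang t)

/-- The word `ℓ_i ℓ_{i+1} ⋯ ℓ_{j-1}` over the `n`-letter alphabet
`{ℓ_0, …, ℓ_{n-1}}` (represented by `Fin n`). -/
def seg (n i j : ℕ) : List (Fin n) :=
  ((List.finRange n).drop i).take (j - i)

/-- The concatenation `w_i w_{i+1} ⋯ w_{j-1}` of the words `w_0, …, w_{n-1}`. -/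
def catSeg {X : Type} {n : ℕ} (ws : Fin n → List X) (i j : ℕ) : List X :=
  (((List.ofFn ws).drop i).take (j - i)).flatten

/-- The words-to-letters valuation `v^⟨w_0, …, w_{n-1}⟩`, a valuation over the
`n`-letter alphabet `{ℓ_0, …, ℓ_{n-1}}` (represented by `Fin n`):
`v^⟨w_0,…,w_{n-1}⟩(x) = {ℓ_i ⋯ ℓ_{j-1} : 0 ≤ i ≤ j ≤ n ∧ w_i ⋯ w_{j-1} ∈ v(x)}`. -/
def wls {X : Type} {n : ℕ} (v : ℕ → Set (List X)) (ws : Fin n → List X) :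
    ℕ → Set (List (Fin n)) :=
  fun x => {u | ∃ i j : ℕ, i ≤ j ∧ j ≤ n ∧ u = seg n i j ∧ catSeg ws i j ∈ v x}

/-- The supremum length `l(t) ∈ ℕ ∪ {ω}`:
`sup({|w| : w ∈ ⟦t⟧_{Ṽ1̄}} ∪ {0})`. -/
noncomputable def suplen (t : Term) : ℕ∞ :=
  ⨆ w ∈ syntacticLang t, (w.length : ℕ∞)

/-- The monoid homomorphism on words extending `f`. -/
def substWord {Y X : Type} (f : Y → List X) (u : List Y) : List X :=
  (u.map f).flatten

theorem substWord_append {Y X : Type} (f : Y → List X) (u w : List Y) :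
    substWord f (u ++ w) = substWord f u ++ substWord f w := by
  simp [substWord]

theorem substWord_flatten {Y X : Type} (f : Y → List X) (us : List (List Y)) :
    substWord f us.flatten = (us.map (substWord f)).flatten := by
  induction us with
  | nil => rfl
  | cons u us ih => simp [substWord_append, ih]

theorem substWord_eq_nil_iff {Y X : Type} {f : Y → List X} (hf : ∀ y, f y ≠ []) (u : List Y) :
    substWord f u = [] ↔ u = [] := by
  cases u <;> simp [substWord, hf]

theorem catSeg_eq_substWord {X : Type} {n : ℕ} (ws : Fin n → List X) (i j : ℕ) :
    catSeg ws i j = substWord ws (seg n i j) := by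
  simp [catSeg, substWord, seg, List.ofFn_eq_map, List.map_take, List.map_drop]

theorem seg_zero_self (n : ℕ) : seg n 0 n = List.finRange n := by
  simp [seg]

theorem seg_infix (n i j : ℕ) : seg n i j <:+: List.finRange n :=
  (List.take_prefix _ _).isInfix.trans (List.drop_suffix _ _).isInfix

theorem exists_eq_seg_of_infix {n : ℕ} {u : List (Fin n)} (hu : u <:+: List.finRange n) :
    ∃ i j : ℕ, i ≤ j ∧ j ≤ n ∧ u = seg n i j := by
  obtain ⟨a, b, h⟩ := hu
  have hlen := congrArg List.length h
  simp only [List.length_append, List.length_finRange] at hlen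
  refine ⟨a.length, a.length + u.length, by omega, by omega, ?_⟩
  simp [seg, ← h]

theorem mem_wls_iff {X : Type} {n : ℕ} (v : ℕ → Set (List X)) (ws : Fin n → List X)
    (x : ℕ) (u : List (Fin n)) :
    u ∈ wls v ws x ↔ u <:+: List.finRange n ∧ substWord ws u ∈ v x := by
  constructor
  · rintro ⟨i, j, -, -, rfl, h⟩
    exact ⟨seg_infix n i j, catSeg_eq_substWord ws i j ▸ h⟩
  · rintro ⟨hu, h⟩
    obtain ⟨i, j, hij, hj, rfl⟩ := exists_eq_seg_of_infix hu
    exact ⟨i, j, hij, hj, rfl, (catSeg_eq_substWord ws i j).symm ▸ h⟩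

theorem substWord_mem_eval {X : Type} {n : ℕ} (v : ℕ → Set (List X)) (ws : Fin n → List X)
    (hws : ∀ k, ws k ≠ []) (s : Term) (u : List (Fin n)) (hu : u <:+: List.finRange n)
    (h : u ∈ eval (wls v ws) s) : substWord ws u ∈ eval v s := by
  induction s generalizing u with
  | var x => exact ((mem_wls_iff v ws x u).1 h).2
  | nvar x => exact fun hx => h ((mem_wls_iff v ws x u).2 ⟨hu, hx⟩)
  | zero => exact h.elim
  | one => exact (substWord_eq_nil_iff hws u).2 h
  | cone => exact fun hnil => h ((substWord_eq_nil_iff hws u).1 hnil)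
  | add t s iht ihs => exact h.imp (iht u hu) (ihs u hu)
  | comp t s iht ihs =>
    obtain ⟨p, hp, q, hq, rfl⟩ := h
    exact ⟨_, iht p ((List.prefix_append p q).isInfix.trans hu) hp,
      _, ihs q ((List.suffix_append p q).isInfix.trans hu) hq, substWord_append ws p q⟩
  | star t ih =>
    obtain ⟨us, hus, rfl⟩ := h
    refine ⟨us.map (substWord ws), ?_, substWord_flatten ws us⟩
    intro w hw
    obtain ⟨p, hp, rfl⟩ := List.mem_map.1 hw
    exact ih p ((List.infix_of_mem_flatten hp).trans hu) (hus p hp)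

/-- The factors `us` realize, letter by letter, the word `α` over `Ṽ_{1̄}`. -/
def Realizes {X : Type} (v : ℕ → Set (List X)) (α : List TLetter) (us : List (List X)) : Prop :=
  List.Forall₂ (fun a u => u ∈ eval v a.toTerm) α us

theorem exists_realizes_of_mem_eval {X : Type} (v : ℕ → Set (List X)) (t : Term) (w : List X)
    (h : w ∈ eval v t) : ∃ α ∈ syntacticLang t, ∃ us, Realizes v α us ∧ w = us.flatten := by
  induction t generalizing w with
  | var x => exact ⟨[.pos x], rfl, [w], .cons h .nil, by simp⟩
  | nvar x => exact ⟨[.neg x], rfl, [w], .cons h .nil, by simp⟩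
  | zero => exact h.elim
  | one => exact ⟨[], rfl, [], .nil, h⟩
  | cone => exact ⟨[.one], rfl, [w], .cons h .nil, by simp⟩
  | add t s iht ihs =>
    rcases h with h | h
    · obtain ⟨α, hα, us⟩ := iht w h
      exact ⟨α, .inl hα, us⟩
    · obtain ⟨α, hα, us⟩ := ihs w h
      exact ⟨α, .inr hα, us⟩
  | comp t s iht ihs =>
    obtain ⟨p, hp, q, hq, rfl⟩ := h
    obtain ⟨α, hα, us, hus, rfl⟩ := iht p hp
    obtain ⟨β, hβ, us', hus', rfl⟩ := ihs q hq
    exact ⟨α ++ β, ⟨α, hα, β, hβ, rfl⟩, us ++ us', List.rel_append hus hus', by simp⟩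
  | star t ih =>
    obtain ⟨ps, hps, rfl⟩ := h
    induction ps with
    | nil => exact ⟨[], ⟨[], by simp, rfl⟩, [], .nil, rfl⟩
    | cons p ps ihps =>
      obtain ⟨α, hα, us, hus, hp⟩ := ih p (hps p (by simp))
      obtain ⟨_, ⟨βs, hβs, rfl⟩, us', hus', hflat⟩ :=
        ihps fun u hu => hps u (List.mem_cons_of_mem p hu)
      refine ⟨α ++ βs.flatten, ⟨α :: βs, ?_, rfl⟩, us ++ us', List.rel_append hus hus', ?_⟩
      · simpa using ⟨hα, hβs⟩
      · simp [hp, hflat]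

theorem Realizes.of_append {X : Type} {v : ℕ → Set (List X)} {α β : List TLetter}
    {us : List (List X)} (h : Realizes v (α ++ β) us) :
    ∃ us₁ us₂, us = us₁ ++ us₂ ∧ Realizes v α us₁ ∧ Realizes v β us₂ :=
  ⟨us.take α.length, us.drop α.length, (List.take_append_drop _ _).symm,
    List.forall₂_take_append _ _ _ h.flip |>.flip, List.forall₂_drop_append _ _ _ h.flip |>.flip⟩

theorem Realizes.flatten_mem_eval {X : Type} {v : ℕ → Set (List X)} {t : Term}
    {α : List TLetter} {us : List (List X)} (h : Realizes v α us) (hα : α ∈ syntacticLang t) :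
    us.flatten ∈ eval v t := by
  induction t generalizing α us with
  | var x => cases hα; obtain _ | ⟨h, ⟨⟩⟩ := h; simpa [TLetter.toTerm] using h
  | nvar x => cases hα; obtain _ | ⟨h, ⟨⟩⟩ := h; simpa [TLetter.toTerm] using h
  | zero => exact hα.elim
  | one => cases hα; cases h; rfl
  | cone => cases hα; obtain _ | ⟨h, ⟨⟩⟩ := h; simpa [TLetter.toTerm] using h
  | add t s iht ihs => exact hα.imp (iht h) (ihs h)
  | comp t s iht ihs =>
    obtain ⟨α, hα, β, hβ, rfl⟩ := hα
    obtain ⟨us₁, us₂, rfl, h₁, h₂⟩ := h.of_append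
    exact ⟨_, iht h₁ hα, _, ihs h₂ hβ, List.flatten_append⟩
  | star t ih =>
    obtain ⟨αs, hαs, rfl⟩ := hα
    induction αs generalizing us with
    | nil => cases h; exact ⟨[], by simp, rfl⟩
    | cons α αs ihαs =>
      obtain ⟨us₁, us₂, rfl, h₁, h₂⟩ := Realizes.of_append (β := αs.flatten) h
      obtain ⟨ps, hps, hflat⟩ := ihαs (fun u hu => hαs u (List.mem_cons_of_mem α hu)) h₂
      refine ⟨us₁.flatten :: ps, ?_, by simp [hflat]⟩
      simpa using ⟨ih h₁ (hαs α (by simp)), hps⟩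

theorem exists_flatten_eq_of_map_eq_filter {Y X : Type} (f : Y → List X) (us : List (List X))
    (ys : List Y) (h : ys.map f = us.filter (fun u => !u.isEmpty)) :
    ∃ ps : List (List Y), ps.flatten = ys ∧ ps.map (substWord f) = us := by
  induction us generalizing ys with
  | nil => exact ⟨[], by simpa using h.symm, rfl⟩
  | cons u us ih =>
    cases u with
    | nil =>
      obtain ⟨ps, hps, hmap⟩ := ih ys (by simpa using h)
      exact ⟨[] :: ps, by simpa using hps, by simp [hmap, substWord]⟩
    | cons a u =>
      cases ys with
      | nil => simp at h
      | cons y ys =>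
        simp only [List.map_cons, List.isEmpty_cons, Bool.not_false, List.filter_cons_of_pos,
          List.cons.injEq] at h
        obtain ⟨ps, hps, hmap⟩ := ih ys h.2
        exact ⟨[y] :: ps, by simp [hps], by simp [hmap, substWord, h.1]⟩

theorem mem_eval_wls_toTerm {X : Type} {n : ℕ} {v : ℕ → Set (List X)} {ws : Fin n → List X}
    {a : TLetter} {p : List (Fin n)} (hp : p <:+: List.finRange n)
    (h : substWord ws p ∈ eval v a.toTerm) : p ∈ eval (wls v ws) a.toTerm := by
  cases a with
  | pos x => exact (mem_wls_iff v ws x p).2 ⟨hp, h⟩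
  | neg x => exact fun hx => h ((mem_wls_iff v ws x p).1 hx).2
  | one => rintro rfl; exact h rfl

theorem exists_wls_of_mem_eval {X : Type} (v : ℕ → Set (List X)) (t : Term) (w : List X)
    (h : w ∈ eval v t) :
    ∃ (m : ℕ) (ws : Fin m → List X), (m : ℕ∞) ≤ suplen t ∧ (∀ k, ws k ≠ []) ∧
      substWord ws (List.finRange m) = w ∧ List.finRange m ∈ eval (wls v ws) t := by
  obtain ⟨α, hα, us, hus, rfl⟩ := exists_realizes_of_mem_eval v t w h
  let ns := us.filter (fun u => !u.isEmpty)
  obtain ⟨ps, hflat, hmap⟩ := exists_flatten_eq_of_map_eq_filter ns.get us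
    (List.finRange ns.length) (by simp [ns])
  refine ⟨ns.length, ns.get, ?_, fun k => ?_, ?_, ?_⟩
  · have hle : ns.length ≤ α.length := hus.length_eq ▸ List.length_filter_le _ us
    exact (Nat.cast_le.2 hle).trans (le_iSup₂_of_le α hα le_rfl)
  · simpa using (List.mem_filter.1 (ns.get_mem k)).2
  · rw [← hflat, substWord_flatten, hmap]
  · have hps : Realizes (wls v ns.get) α ps := by
      have hinfix : ∀ p ∈ ps, p <:+: List.finRange ns.length := fun p hp =>
        hflat ▸ List.infix_of_mem_flatten hp
      rw [← hmap, Realizes, List.forall₂_map_right_iff] at hus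
      generalize ns.get = f at hus ⊢
      clear hmap hflat h hα
      induction hus with
      | nil => exact .nil
      | cons hp _ ih =>
        exact .cons (mem_eval_wls_toTerm (hinfix _ (by simp)) hp)
          (ih fun q hq => hinfix q (List.mem_cons_of_mem _ hq))
    have hmem := hps.flatten_mem_eval hα
    rwa [hflat] at hmem

/-- For `KA_{x̄,1̄}` terms `t`, `s`, the following are equivalent:
(1) `LANG ⊨ t ≤ s`; (2) for every `m ≤ l(t)` and every valuation over
`{ℓ_0, …, ℓ_{m-1}}` whose values consist of contiguous subwords of
`ℓ_0 ⋯ ℓ_{m-1}`, `v̂(t) ⊆ v̂(s)`; (3) for every words-to-letters valuation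
`v^⟨w_0,…,w_{m-1}⟩` with `m ≤ l(t)` and nonempty `w_0, …, w_{m-1}`,
`v̂^⟨w_0,…,w_{m-1}⟩(t) ⊆ v̂^⟨w_0,…,w_{m-1}⟩(s)`. -/
theorem stmt11 (t s : Term) :
    List.TFAE
      [∀ (X : Type) (v : ℕ → Set (List X)), eval v t ⊆ eval v s,
       ∀ m : ℕ, (m : ℕ∞) ≤ suplen t → ∀ v : ℕ → Set (List (Fin m)),
         (∀ x : ℕ, v x ⊆ {w | w <:+: seg m 0 m}) →
         eval v t ⊆ eval v s,
       ∀ (X : Type) (m : ℕ), (m : ℕ∞) ≤ suplen t →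
         ∀ (v : ℕ → Set (List X)) (ws : Fin m → List X), (∀ k, ws k ≠ []) →
         eval (wls v ws) t ⊆ eval (wls v ws) s] := by
  tfae_have 1 → 2 := fun h m _ v _ => h (Fin m) v
  tfae_have 2 → 3 := fun h X m hm v ws _ => h m hm (wls v ws) fun x u hu =>
    (seg_zero_self m).symm ▸ ((mem_wls_iff v ws x u).1 hu).1
  tfae_have 3 → 1 := by
    intro h X v w hw
    obtain ⟨m, ws, hm, hws, rfl, hmem⟩ := exists_wls_of_mem_eval v t w hw
    exact substWord_mem_eval v ws hws s _ List.infix_rfl (h X m hm v ws hws hmem)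
  tfae_finish
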